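/- arXiv:2412.12944 — 6 statements merged into one kernel-verified Lean document; each statement's English description precedes it below -/
import Mathlib

section
/- Let X and Y be real Hilbert spaces, K : X → Y a bounded linear operator, τ, σ > 0 and L ≥ 0 with Lτ + τσ‖K‖² < 1. Then for every u = (x, y) ∈ X × Y one has ⟨Mu, u⟩ − L‖x‖² ≥ (τ⁻¹ − L − σ‖K‖²)‖x‖² ≥ 0; in particular both M and M − diag(L·Id, 0) (the operator (x, y) ↦ (τ⁻¹x − K*y − Lx, σ⁻¹y − Kx)) are positive semidefinite on X × Y. -/
open scoped RealInnerProductSpace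

/-- The quadratic form `⟨M u, u⟩` of the primal-dual preconditioning operator
`M(x, y) := (τ⁻¹ x − K* y, σ⁻¹ y − K x)` on the product Hilbert space `X × Y`. -/
noncomputable def Mquad {X Y : Type*} [NormedAddCommGroup X] [InnerProductSpace ℝ X]
    [CompleteSpace X] [NormedAddCommGroup Y] [InnerProductSpace ℝ Y] [CompleteSpace Y]
    (K : X →L[ℝ] Y) (τ σ : ℝ) (u : X × Y) : ℝ :=
  ⟪τ⁻¹ • u.1 - (ContinuousLinearMap.adjoint K) u.2, u.1⟫ +
    ⟪σ⁻¹ • u.2 - K u.1, u.2⟫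

/-- The quadratic form of the preconditioner, expanded. -/
theorem Mquad_eq {X Y : Type*} [NormedAddCommGroup X] [InnerProductSpace ℝ X]
    [CompleteSpace X] [NormedAddCommGroup Y] [InnerProductSpace ℝ Y] [CompleteSpace Y]
    (K : X →L[ℝ] Y) (τ σ : ℝ) (u : X × Y) :
    Mquad K τ σ u = τ⁻¹ * ‖u.1‖ ^ 2 + σ⁻¹ * ‖u.2‖ ^ 2 - 2 * ⟪K u.1, u.2⟫ := by
  rw [Mquad, inner_sub_left, inner_sub_left, real_inner_smul_left, real_inner_smul_left,
    ContinuousLinearMap.adjoint_inner_left, real_inner_self_eq_norm_sq,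
    real_inner_self_eq_norm_sq, real_inner_comm u.2]
  ring

/-- Young's inequality for a real inner product. -/
theorem two_mul_real_inner_le {E : Type*} [NormedAddCommGroup E] [InnerProductSpace ℝ E]
    {σ : ℝ} (hσ : 0 < σ) (a b : E) :
    2 * ⟪a, b⟫ ≤ σ * ‖a‖ ^ 2 + σ⁻¹ * ‖b‖ ^ 2 := by
  have h : 0 ≤ σ⁻¹ * ‖σ • a - b‖ ^ 2 := by positivity
  rw [norm_sub_sq_real, norm_smul, real_inner_smul_left, mul_pow, Real.norm_eq_abs, sq_abs] at h
  have e : σ⁻¹ * (σ ^ 2 * ‖a‖ ^ 2 - 2 * (σ * ⟪a, b⟫) + ‖b‖ ^ 2) =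
      σ * ‖a‖ ^ 2 - 2 * ⟪a, b⟫ + σ⁻¹ * ‖b‖ ^ 2 := by
    field_simp
  linarith

/-- if `Lτ + τσ‖K‖² < 1` then `⟨Mu, u⟩ − L‖x‖² ≥ (τ⁻¹ − L − σ‖K‖²)‖x‖² ≥ 0`;
in particular both `M` and `M − diag(L·Id, 0)` are positive semidefinite. -/
theorem stmt0
    {X Y : Type*} [NormedAddCommGroup X] [InnerProductSpace ℝ X] [CompleteSpace X]
    [NormedAddCommGroup Y] [InnerProductSpace ℝ Y] [CompleteSpace Y]
    (K : X →L[ℝ] Y) (τ σ L : ℝ) (hτ : 0 < τ) (hσ : 0 < σ) (hL : 0 ≤ L)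
    (hstep : L * τ + τ * σ * ‖K‖ ^ 2 < 1) :
    ∀ u : X × Y,
      (Mquad K τ σ u - L * ‖u.1‖ ^ 2 ≥ (τ⁻¹ - L - σ * ‖K‖ ^ 2) * ‖u.1‖ ^ 2) ∧
      ((τ⁻¹ - L - σ * ‖K‖ ^ 2) * ‖u.1‖ ^ 2 ≥ 0) ∧
      (0 ≤ Mquad K τ σ u) ∧
      (0 ≤ Mquad K τ σ u - L * ‖u.1‖ ^ 2) := by
  intro u
  have hK : σ * ‖K u.1‖ ^ 2 ≤ σ * (‖K‖ * ‖u.1‖) ^ 2 := by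
    gcongr
    exact K.le_opNorm u.1
  have hlower : (τ⁻¹ - L - σ * ‖K‖ ^ 2) * ‖u.1‖ ^ 2 ≤ Mquad K τ σ u - L * ‖u.1‖ ^ 2 := by
    rw [Mquad_eq]
    linarith [two_mul_real_inner_le hσ (K u.1) u.2]
  have hcoef : 0 ≤ τ⁻¹ - L - σ * ‖K‖ ^ 2 := by
    have h : L + σ * ‖K‖ ^ 2 ≤ τ⁻¹ := by
      rw [← one_div, le_div_iff₀ hτ]
      linarith
    linarith
  have hnonneg : 0 ≤ (τ⁻¹ - L - σ * ‖K‖ ^ 2) * ‖u.1‖ ^ 2 := by positivity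
  have hLx : 0 ≤ L * ‖u.1‖ ^ 2 := by positivity
  exact ⟨hlower, hnonneg, by linarith, hnonneg.trans hlower⟩
end

section
/- Let X, Y be real Hilbert spaces, K : X → Y bounded linear, τ, σ > 0, and γ, ρ, γE, L, e ≥ 0. Let F : X → ℝ ∪ {+∞} and G* : Y → ℝ ∪ {+∞} be proper convex, E : X → ℝ, and g ∈ X. Let u = (x, y), ŭ = (x̆, y̆), ū = (x̄, ȳ) ∈ X × Y with F(x̄) and G*(ȳ) finite. Assume: (a) there exist a γ-strong subgradient q of F at x and a ρ-strong subgradient p of G* at y such that q + g + K*y + τ⁻¹(x − x̆) − K*(y − y̆) = 0 and p − Kx + σ⁻¹(y − y̆) − K(x − x̆) = 0; (b) for all x' ∈ X, ⟨g, x' − x̄⟩ ≥ E(x') − E(x̄) + (γE/2)‖x' − x̄‖² − (L/2)‖x' − x̆‖² − e. Then, with the Lagrangian duality gap 𝒢 := (F(x) + E(x) + ⟨Kx, ȳ⟩ − G*(ȳ)) − (F(x̄) + E(x̄) + ⟨y, Kx̄⟩ − G*(y)), one has ½‖ŭ − ū‖²_M + e ≥ ½‖u − ū‖²_M + ((γ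 + γE)/2)‖x − x̄‖² + (ρ/2)‖y − ȳ‖² + 𝒢 + ½(‖u − ŭ‖²_M − L‖x − x̆‖²). -/
open scoped RealInnerProductSpace

/-- `q` is a `γ`-strong subgradient of the extended-real-valued convex function `F` at `x`:
`F x` is finite and `F x' ≥ F x + ⟨q, x' − x⟩ + (γ/2)‖x' − x‖²` for all `x'`. -/
def IsStrongSubgradient {X : Type*} [NormedAddCommGroup X] [InnerProductSpace ℝ X]
    (γ : ℝ) (F : X → EReal) (x q : X) : Prop :=
  F x ≠ ⊤ ∧ F x ≠ ⊥ ∧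
    ∀ x' : X, F x' ≥ F x + ((⟪q, x' - x⟫ + γ / 2 * ‖x' - x‖ ^ 2 : ℝ) : EReal)

/-- `F` is proper (nowhere `−∞`, finite somewhere) and convex. -/
def ProperConvex {X : Type*} [NormedAddCommGroup X] [InnerProductSpace ℝ X]
    (F : X → EReal) : Prop :=
  (∀ v, F v ≠ ⊥) ∧ (∃ v, F v ≠ ⊤) ∧
    ∀ v w : X, ∀ t : ℝ, 0 ≤ t → t ≤ 1 →
      F (t • v + (1 - t) • w) ≤ (t : EReal) * F v + ((1 - t : ℝ) : EReal) * F w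

/-- A strong subgradient inequality between two points of finiteness, as an inequality in `ℝ`. -/
theorem IsStrongSubgradient.toReal_add_le {X : Type*} [NormedAddCommGroup X]
    [InnerProductSpace ℝ X] {γ : ℝ} {F : X → EReal} {x q x' : X}
    (h : IsStrongSubgradient γ F x q) (hx' : F x' ≠ ⊤ ∧ F x' ≠ ⊥) :
    (F x).toReal + (γ / 2 * ‖x - x'‖ ^ 2 - ⟪q, x - x'⟫) ≤ (F x').toReal := by
  obtain ⟨h_top, h_bot, hle⟩ := h
  have key := hle x'
  rw [← EReal.coe_toReal hx'.1 hx'.2, ← EReal.coe_toReal h_top h_bot, ge_iff_le,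
    ← EReal.coe_add, EReal.coe_le_coe_iff, norm_sub_rev, ← neg_sub x x', inner_neg_right] at key
  linarith

/-- The three-point identity for the quadratic form of the preconditioner. -/
theorem Mquad_add {X Y : Type*} [NormedAddCommGroup X] [InnerProductSpace ℝ X]
    [CompleteSpace X] [NormedAddCommGroup Y] [InnerProductSpace ℝ Y] [CompleteSpace Y]
    (K : X →L[ℝ] Y) (τ σ : ℝ) (v w : X × Y) :
    Mquad K τ σ w = Mquad K τ σ (v + w) + Mquad K τ σ v
      - 2 * (⟪τ⁻¹ • v.1 - (ContinuousLinearMap.adjoint K) v.2, (v + w).1⟫ +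
        ⟪σ⁻¹ • v.2 - K v.1, (v + w).2⟫) := by
  simp only [Mquad, Prod.fst_add, Prod.snd_add, map_add, smul_add, inner_sub_left, inner_add_left,
    inner_add_right, real_inner_smul_left, ContinuousLinearMap.adjoint_inner_left]
  rw [real_inner_comm v.1 w.1, real_inner_comm v.2 w.2, real_inner_comm (K v.1) w.2,
    real_inner_comm (K w.1) v.2]
  ring

/-- one-step estimate for the nonconvex predictive primal-dual method. -/
theorem stmt2
    {X Y : Type*} [NormedAddCommGroup X] [InnerProductSpace ℝ X] [CompleteSpace X]
    [NormedAddCommGroup Y] [InnerProductSpace ℝ Y] [CompleteSpace Y]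
    (K : X →L[ℝ] Y) (τ σ γ ρ γE L e : ℝ)
    (hτ : 0 < τ) (hσ : 0 < σ) (hγ : 0 ≤ γ) (hρ : 0 ≤ ρ) (hγE : 0 ≤ γE)
    (hL : 0 ≤ L) (he : 0 ≤ e)
    (F : X → EReal) (Gs : Y → EReal) (hF : ProperConvex F) (hGs : ProperConvex Gs)
    (E : X → ℝ) (g : X)
    (u ubrev ubar : X × Y)
    (hFbar : F ubar.1 ≠ ⊤ ∧ F ubar.1 ≠ ⊥)
    (hGbar : Gs ubar.2 ≠ ⊤ ∧ Gs ubar.2 ≠ ⊥)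
    -- (a) the implicit update inclusion
    (hstep : ∃ q p, IsStrongSubgradient γ F u.1 q ∧ IsStrongSubgradient ρ Gs u.2 p ∧
      q + g + (ContinuousLinearMap.adjoint K) u.2 + τ⁻¹ • (u.1 - ubrev.1)
        - (ContinuousLinearMap.adjoint K) (u.2 - ubrev.2) = 0 ∧
      p - K u.1 + σ⁻¹ • (u.2 - ubrev.2) - K (u.1 - ubrev.1) = 0)
    -- (b) the three-point smoothness/growth inequality for E
    (hE : ∀ x' : X, ⟪g, x' - ubar.1⟫ ≥ E x' - E ubar.1 + γE / 2 * ‖x' - ubar.1‖ ^ 2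
        - L / 2 * ‖x' - ubrev.1‖ ^ 2 - e) :
    -- conclusion, with the Lagrangian duality gap written out
    (1 / 2) * Mquad K τ σ (ubrev - ubar) + e
      ≥ (1 / 2) * Mquad K τ σ (u - ubar)
        + (γ + γE) / 2 * ‖u.1 - ubar.1‖ ^ 2 + ρ / 2 * ‖u.2 - ubar.2‖ ^ 2
        + (((F u.1).toReal + E u.1 + ⟪K u.1, ubar.2⟫ - (Gs ubar.2).toReal)
            - ((F ubar.1).toReal + E ubar.1 + ⟪u.2, K ubar.1⟫ - (Gs u.2).toReal))
        + (1 / 2) * (Mquad K τ σ (u - ubrev) - L * ‖u.1 - ubrev.1‖ ^ 2) := by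
  obtain ⟨q, p, hq, hp, hx, hy⟩ := hstep
  have hFle := hq.toReal_add_le hFbar
  have hGle := hp.toReal_add_le hGbar
  have hM := Mquad_add K τ σ (u - ubrev) (ubrev - ubar)
  rw [sub_add_sub_cancel] at hM
  have hEu := hE u.1
  have hx' := congrArg (fun z => ⟪z, u.1 - ubar.1⟫) hx
  have hy' := congrArg (fun z => ⟪z, u.2 - ubar.2⟫) hy
  have hgap : ⟪u.2, K (u.1 - ubar.1)⟫ - ⟪K u.1, u.2 - ubar.2⟫
      = ⟪K u.1, ubar.2⟫ - ⟪u.2, K ubar.1⟫ := by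
    rw [map_sub, inner_sub_right, inner_sub_right, real_inner_comm (K u.1) u.2]
    ring
  simp only [Prod.fst_sub, Prod.snd_sub, inner_sub_left (𝕜 := ℝ) (τ⁻¹ • _),
    inner_sub_left (𝕜 := ℝ) (σ⁻¹ • _)] at hM
  simp only [inner_sub_left (_ + _), inner_sub_left p, inner_add_left, inner_zero_left,
    ContinuousLinearMap.adjoint_inner_left (A := K) (y := u.2)] at hx' hy'
  linarith
end

section
/- For all x₁, x₂ ∈ 𝒜 (i.e. x_m ≤ x_i ≤ x_M μ-a.e.), the solutions of the parametrized variational problem satisfy ‖w_{x₂} − w_{x₁}‖ ≤ C₃ ‖x₂ − x₁‖_{L^∞}. -/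
open MeasureTheory
open scoped RealInnerProductSpace

/-- The weighted `L²` pairing is the `L²` inner product of the Hölder product `x • f` with `g`. -/
theorem integral_mul_inner_eq_inner_smul {Ω E : Type*} [MeasurableSpace Ω] {μ : Measure Ω}
    [NormedAddCommGroup E] [InnerProductSpace ℝ E] (x : Lp ℝ ⊤ μ) (f g : Lp E 2 μ) :
    ∫ ω, x ω * ⟪f ω, g ω⟫ ∂μ = ⟪(x • f : Lp E 2 μ), g⟫ := by
  rw [L2.inner_def]
  refine integral_congr_ae ?_
  filter_upwards [Lp.coeFn_lpSMul (r := 2) x f] with ω hω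
  rw [hω, Pi.smul_apply', real_inner_smul_left]

/-- Lipschitz dependence of the solution of the parametrized variational
problem (abstract complete electrode model) on the `L^∞` coefficient:
`‖w_{x₂} − w_{x₁}‖ ≤ C₃‖x₂ − x₁‖_{L^∞}` with `C₃ = C₁ C₂ = C₁ (C₁ ‖ℓ‖)`. -/
theorem stmt7
    {Ω : Type*} [MeasurableSpace Ω] (μ : Measure Ω) (d : ℕ) (hd : 1 ≤ d)
    {H : Type*} [NormedAddCommGroup H] [InnerProductSpace ℝ H] [CompleteSpace H]
    (D : H →L[ℝ] Lp (EuclideanSpace ℝ (Fin d)) 2 μ)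
    (hD : ∀ w : H, ‖D w‖ ≤ ‖w‖)
    (B₀ : H →L[ℝ] H →L[ℝ] ℝ) (ℓ : H →L[ℝ] ℝ)
    (xm xM C₁ : ℝ) (hxm : 0 < xm) (hxmM : xm < xM) (hC₁ : 0 < C₁)
    -- coercivity of `B_x` for all admissible coefficients
    (hcoer : ∀ x : Lp ℝ ⊤ μ, (∀ᵐ ω ∂μ, xm / 2 ≤ x ω ∧ x ω ≤ xM + xm / 2) →
      ∀ w : H, ‖w‖ ^ 2 ≤ C₁ * (B₀ w w + ∫ ω, x ω * ⟪(D w) ω, (D w) ω⟫ ∂μ))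
    -- `W x` is the Lax–Milgram solution of `B_x(w_x, ·) = ℓ`
    (W : Lp ℝ ⊤ μ → H)
    (hW : ∀ x : Lp ℝ ⊤ μ, (∀ᵐ ω ∂μ, xm / 2 ≤ x ω ∧ x ω ≤ xM + xm / 2) →
      ∀ w : H, B₀ (W x) w + ∫ ω, x ω * ⟪(D (W x)) ω, (D w) ω⟫ ∂μ = ℓ w)
    (x₁ x₂ : Lp ℝ ⊤ μ)
    (hx₁ : ∀ᵐ ω ∂μ, xm ≤ x₁ ω ∧ x₁ ω ≤ xM)
    (hx₂ : ∀ᵐ ω ∂μ, xm ≤ x₂ ω ∧ x₂ ω ≤ xM) :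
    ‖W x₂ - W x₁‖ ≤ C₁ * (C₁ * ‖ℓ‖) * ‖x₂ - x₁‖ := by
  simp only [integral_mul_inner_eq_inner_smul] at hcoer hW
  have admissible {x : Lp ℝ ⊤ μ} (hx : ∀ᵐ ω ∂μ, xm ≤ x ω ∧ x ω ≤ xM) :
      ∀ᵐ ω ∂μ, xm / 2 ≤ x ω ∧ x ω ≤ xM + xm / 2 := by
    filter_upwards [hx] with ω hω
    constructor <;> linarith [hω.1, hω.2]
  have le_of_sq_le {a c : ℝ} (ha : 0 ≤ a) (hc : 0 ≤ c) (h : a ^ 2 ≤ c * a) : a ≤ c := by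
    by_contra! hlt
    nlinarith
  have norm_W_le : ‖W x₁‖ ≤ C₁ * ‖ℓ‖ := by
    refine le_of_sq_le (norm_nonneg _) (by positivity) ?_
    have h := hcoer x₁ (admissible hx₁) (W x₁)
    rw [hW x₁ (admissible hx₁)] at h
    rw [mul_assoc]
    exact h.trans (mul_le_mul_of_nonneg_left ((le_abs_self _).trans (ℓ.le_opNorm _)) hC₁.le)
  set δ := W x₂ - W x₁ with hδ
  have residual : B₀ δ δ + ⟪(x₂ • D δ : Lp (EuclideanSpace ℝ (Fin d)) 2 μ), D δ⟫ =
      ⟪((x₁ - x₂) • D (W x₁) : Lp (EuclideanSpace ℝ (Fin d)) 2 μ), D δ⟫ := by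
    have h₁ := hW x₁ (admissible hx₁) δ
    have h₂ := hW x₂ (admissible hx₂) δ
    have hB : B₀ δ δ = B₀ (W x₂) δ - B₀ (W x₁) δ := by
      rw [hδ, map_sub B₀, sub_apply]
    have hx : (x₂ • D δ : Lp (EuclideanSpace ℝ (Fin d)) 2 μ) =
        x₂ • D (W x₂) - x₂ • D (W x₁) := by
      rw [hδ, map_sub D, sub_eq_add_neg, Lp.add_smul, Lp.smul_neg, ← sub_eq_add_neg]
    have hxx : ((x₁ - x₂) • D (W x₁) : Lp (EuclideanSpace ℝ (Fin d)) 2 μ) =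
        x₁ • D (W x₁) - x₂ • D (W x₁) := by
      rw [sub_eq_add_neg, Lp.smul_add, Lp.neg_smul, ← sub_eq_add_neg]
    rw [hB, hx, hxx, inner_sub_left, inner_sub_left]
    linarith
  refine le_of_sq_le (norm_nonneg _) (by positivity) ?_
  calc ‖δ‖ ^ 2
      ≤ C₁ * ⟪((x₁ - x₂) • D (W x₁) : Lp (EuclideanSpace ℝ (Fin d)) 2 μ), D δ⟫ :=
        residual ▸ hcoer x₂ (admissible hx₂) δ
    _ ≤ C₁ * (‖x₁ - x₂‖ * (C₁ * ‖ℓ‖) * ‖δ‖) := by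
        gcongr
        refine (real_inner_le_norm _ _).trans ?_
        gcongr
        · refine (Lp.norm_smul_le _ _).trans ?_
          gcongr
          exact (hD _).trans norm_W_le
        · exact hD δ
    _ = C₁ * (C₁ * ‖ℓ‖) * ‖x₂ - x₁‖ * ‖δ‖ := by
        rw [norm_sub_rev]
        ring
end

section
/- Fix x ∈ 𝒜. For each h ∈ L^∞(Ω, μ) there is a unique w′_x(h) ∈ 𝓗 with B_x(w′_x(h), w) = −∫_Ω h ⟨Dw_x, Dw⟩ dμ for all w ∈ 𝓗; the map h ↦ w′_x(h) is linear and satisfies ‖w′_x(h)‖ ≤ C₃‖h‖_{L^∞}; and for every h ∈ L^∞ with ‖h‖_{L^∞} ≤ x_m/2 one has ‖w_{x+h} − w_x − w′_x(h)‖ ≤ C₁C₃‖h‖²_{L^∞}. In particular the solution map x ↦ w_x is Fréchet differentiable at x as a map from L^∞(Ω, μ) to 𝓗, with derivative h ↦ w′_x(h) of operator norm at most C₃. -/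
open MeasureTheory
open scoped RealInnerProductSpace

section Coercive

variable {V H : Type*} [NormedAddCommGroup V] [NormedSpace ℝ V]
  [NormedAddCommGroup H] [InnerProductSpace ℝ H] {a : H →L[ℝ] H →L[ℝ] ℝ} {C : ℝ}

theorem norm_le_mul_norm_apply_of_coercive (hC : 0 < C) (ha : ∀ v, ‖v‖ ^ 2 ≤ C * a v v) (v : H) :
    ‖v‖ ≤ C * ‖a v‖ := by
  rcases (norm_nonneg v).eq_or_lt with h | h
  · rw [← h]
    positivity
  · refine le_of_mul_le_mul_right ?_ h
    have h₁ : a v v ≤ ‖a v‖ * ‖v‖ := (le_abs_self _).trans ((a v).le_opNorm v)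
    calc ‖v‖ * ‖v‖ = ‖v‖ ^ 2 := (sq _).symm
      _ ≤ C * a v v := ha v
      _ ≤ C * (‖a v‖ * ‖v‖) := by gcongr
      _ = C * ‖a v‖ * ‖v‖ := (mul_assoc _ _ _).symm

theorem injective_of_coercive (hC : 0 < C) (ha : ∀ v, ‖v‖ ^ 2 ≤ C * a v v) :
    Function.Injective a := by
  refine (injective_iff_map_eq_zero a).2 fun v hv ↦ norm_le_zero_iff.1 ?_
  simpa [hv] using norm_le_mul_norm_apply_of_coercive hC ha v

theorem surjective_of_coercive [CompleteSpace H] (hC : 0 < C)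
    (ha : ∀ v, ‖v‖ ^ 2 ≤ C * a v v) : Function.Surjective a := by
  have hcoer : IsCoercive a := by
    refine ⟨C⁻¹, inv_pos.2 hC, fun u ↦ ?_⟩
    rw [mul_assoc, inv_mul_le_iff₀ hC, ← sq]
    exact ha u
  intro φ
  refine ⟨hcoer.continuousLinearEquivOfBilin.symm ((InnerProductSpace.toDual ℝ H).symm φ), ?_⟩
  ext w
  rw [← hcoer.continuousLinearEquivOfBilin_apply, ContinuousLinearEquiv.apply_symm_apply,
    InnerProductSpace.toDual_symm_apply]

/-- Parametrized Lax–Milgram theorem: the solution depends linearly and continuously on the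
parameter of the right-hand side. -/
theorem exists_solution_clm_of_coercive [CompleteSpace H] (hC : 0 < C)
    (ha : ∀ v, ‖v‖ ^ 2 ≤ C * a v v) (f : V →L[ℝ] H →L[ℝ] ℝ) :
    ∃ T : V →L[ℝ] H, ∀ h, a (T h) = f h := by
  choose S hS using fun h ↦ surjective_of_coercive hC ha (f h)
  have hinj := injective_of_coercive hC ha
  let L : V →ₗ[ℝ] H :=
    { toFun := S
      map_add' := fun h k ↦ hinj (by simp [hS])
      map_smul' := fun c h ↦ hinj (by simp [hS]) }
  refine ⟨L.mkContinuous (C * ‖f‖) fun h ↦ ?_, hS⟩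
  calc ‖S h‖ ≤ C * ‖f h‖ := hS h ▸ norm_le_mul_norm_apply_of_coercive hC ha (S h)
    _ ≤ C * (‖f‖ * ‖h‖) := by gcongr; exact f.le_opNorm h
    _ = C * ‖f‖ * ‖h‖ := (mul_assoc _ _ _).symm

end Coercive

section WeightedInner

variable {Ω E : Type*} [MeasurableSpace Ω] [NormedAddCommGroup E] [InnerProductSpace ℝ E]

/-- The trilinear form `(h, f, g) ↦ ∫ h ⟪f, g⟫ ∂μ` on `L^∞ × L² × L²`. -/
noncomputable def weightedInnerL (μ : Measure Ω) :
    Lp ℝ ⊤ μ →L[ℝ] Lp E 2 μ →L[ℝ] Lp E 2 μ →L[ℝ] ℝ :=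
  (ContinuousLinearMap.compL ℝ (Lp E 2 μ) (Lp E 2 μ) (Lp E 2 μ →L[ℝ] ℝ) (innerSL ℝ)) ∘L
    (ContinuousLinearMap.lsmul ℝ ℝ : ℝ →L[ℝ] E →L[ℝ] E).holderL μ ⊤ 2 2

variable {μ : Measure Ω}

theorem weightedInnerL_apply (h : Lp ℝ ⊤ μ) (f g : Lp E 2 μ) :
    weightedInnerL μ h f g = ∫ ω, h ω * ⟪f ω, g ω⟫ ∂μ := by
  change ⟪(ContinuousLinearMap.lsmul ℝ ℝ : ℝ →L[ℝ] E →L[ℝ] E).holder 2 h f, g⟫ = _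
  rw [L2.inner_def]
  refine integral_congr_ae ?_
  filter_upwards [(ContinuousLinearMap.lsmul ℝ ℝ : ℝ →L[ℝ] E →L[ℝ] E).coeFn_holder
    (r := 2) h f] with ω hω
  rw [hω, ContinuousLinearMap.lsmul_apply, real_inner_smul_left]

theorem norm_weightedInnerL_apply_le (h : Lp ℝ ⊤ μ) (f : Lp E 2 μ) :
    ‖weightedInnerL μ h f‖ ≤ ‖h‖ * ‖f‖ := by
  let S : ℝ →L[ℝ] E →L[ℝ] E := ContinuousLinearMap.lsmul ℝ ℝ
  calc ‖weightedInnerL μ h f‖ = ‖S.holder 2 h f‖ := innerSL_apply_norm ℝ _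
    _ ≤ ‖S‖ * ‖h‖ * ‖f‖ := S.norm_holder_apply_apply_le h f
    _ ≤ 1 * ‖h‖ * ‖f‖ := by gcongr; exact ContinuousLinearMap.opNorm_lsmul_le
    _ = ‖h‖ * ‖f‖ := by rw [one_mul]

theorem ae_abs_le_norm_of_Lp_top (h : Lp ℝ ⊤ μ) : ∀ᵐ ω ∂μ, |h ω| ≤ ‖h‖ := by
  filter_upwards [ae_le_eLpNormEssSup (f := h) (μ := μ)] with ω hω
  rw [Lp.norm_def, eLpNorm_exponent_top, ← Real.norm_eq_abs, ← toReal_enorm]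
  refine ENNReal.toReal_mono ?_ hω
  rw [← eLpNorm_exponent_top]
  exact Lp.eLpNorm_ne_top h

end WeightedInner

theorem hasFDerivAt_of_norm_sub_le_sq {V H : Type*} [NormedAddCommGroup V] [NormedSpace ℝ V]
    [NormedAddCommGroup H] [NormedSpace ℝ H] {W : V → H} {T : V →L[ℝ] H} {x : V} {r K : ℝ}
    (hr : 0 < r) (hW : ∀ h, ‖h‖ ≤ r → ‖W (x + h) - W x - T h‖ ≤ K * ‖h‖ ^ 2) :
    HasFDerivAt W T x := by
  rw [hasFDerivAt_iff_isLittleO_nhds_zero]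
  refine Asymptotics.IsBigO.trans_isLittleO (g := fun h : V ↦ ‖h‖ ^ 2) ?_
    (Asymptotics.isLittleO_norm_pow_id one_lt_two)
  refine Asymptotics.IsBigO.of_bound K ?_
  filter_upwards [Metric.closedBall_mem_nhds (0 : V) hr] with h hh
  simpa using hW h (by simpa using hh)

/-- first-order Fréchet differentiability in `L^∞` of the solution map of
the parametrized variational problem (abstract complete electrode model), with the
derivative characterized by `B_x(w′_x(h), w) = −∫ h ⟨Dw_x, Dw⟩ dμ`, norm-bounded by
`C₃ = C₁(C₁‖ℓ‖)`, with quadratic Taylor remainder bound `C₁C₃‖h‖²`. -/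
theorem stmt8
    {Ω : Type*} [MeasurableSpace Ω] (μ : Measure Ω) (d : ℕ) (hd : 1 ≤ d)
    {H : Type*} [NormedAddCommGroup H] [InnerProductSpace ℝ H] [CompleteSpace H]
    (D : H →L[ℝ] Lp (EuclideanSpace ℝ (Fin d)) 2 μ)
    (hD : ∀ w : H, ‖D w‖ ≤ ‖w‖)
    (B₀ : H →L[ℝ] H →L[ℝ] ℝ) (ℓ : H →L[ℝ] ℝ)
    (xm xM C₁ : ℝ) (hxm : 0 < xm) (hxmM : xm < xM) (hC₁ : 0 < C₁)
    (hcoer : ∀ x : Lp ℝ ⊤ μ, (∀ᵐ ω ∂μ, xm / 2 ≤ x ω ∧ x ω ≤ xM + xm / 2) →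
      ∀ w : H, ‖w‖ ^ 2 ≤ C₁ * (B₀ w w + ∫ ω, x ω * ⟪(D w) ω, (D w) ω⟫ ∂μ))
    (W : Lp ℝ ⊤ μ → H)
    (hW : ∀ x : Lp ℝ ⊤ μ, (∀ᵐ ω ∂μ, xm / 2 ≤ x ω ∧ x ω ≤ xM + xm / 2) →
      ∀ w : H, B₀ (W x) w + ∫ ω, x ω * ⟪(D (W x)) ω, (D w) ω⟫ ∂μ = ℓ w)
    (x : Lp ℝ ⊤ μ) (hx : ∀ᵐ ω ∂μ, xm ≤ x ω ∧ x ω ≤ xM) :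
    ∃ W' : Lp ℝ ⊤ μ →L[ℝ] H,
      -- defining weak equation for the derivative
      (∀ h : Lp ℝ ⊤ μ, ∀ w : H,
        B₀ (W' h) w + ∫ ω, x ω * ⟪(D (W' h)) ω, (D w) ω⟫ ∂μ
          = -∫ ω, h ω * ⟪(D (W x)) ω, (D w) ω⟫ ∂μ) ∧
      -- uniqueness of the solution of the weak equation
      (∀ h : Lp ℝ ⊤ μ, ∀ v : H,
        (∀ w : H, B₀ v w + ∫ ω, x ω * ⟪(D v) ω, (D w) ω⟫ ∂μ
          = -∫ ω, h ω * ⟪(D (W x)) ω, (D w) ω⟫ ∂μ) → v = W' h) ∧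
      -- norm bounds
      (∀ h : Lp ℝ ⊤ μ, ‖W' h‖ ≤ C₁ * (C₁ * ‖ℓ‖) * ‖h‖) ∧
      ‖W'‖ ≤ C₁ * (C₁ * ‖ℓ‖) ∧
      -- quadratic Taylor remainder estimate
      (∀ h : Lp ℝ ⊤ μ, ‖h‖ ≤ xm / 2 →
        ‖W (x + h) - W x - W' h‖ ≤ C₁ * (C₁ * (C₁ * ‖ℓ‖)) * ‖h‖ ^ 2) ∧
      -- Fréchet differentiability of the solution map at `x`
      HasFDerivAt W W' x := by

  let M := weightedInnerL (E := EuclideanSpace ℝ (Fin d)) μ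
  let a : Lp ℝ ⊤ μ → H →L[ℝ] H →L[ℝ] ℝ := fun y ↦ B₀ + (M y).bilinearComp D D
  have ha_apply (y : Lp ℝ ⊤ μ) (v w : H) :
      a y v w = B₀ v w + ∫ ω, y ω * ⟪(D v) ω, (D w) ω⟫ ∂μ := by
    rw [← weightedInnerL_apply]
    rfl
  have ha_add (y h : Lp ℝ ⊤ μ) (v : H) : a (y + h) v = a y v + M h (D v) ∘L D := by
    ext w
    change B₀ v w + M (y + h) (D v) (D w) = B₀ v w + M y (D v) (D w) + M h (D v) (D w)
    rw [map_add, add_apply, add_apply, add_assoc]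
  have hM (h : Lp ℝ ⊤ μ) (v : H) : ‖M h (D v) ∘L D‖ ≤ ‖h‖ * ‖v‖ := by
    have hD1 : ‖D‖ ≤ 1 := D.opNorm_le_bound zero_le_one (by simpa using hD)
    calc ‖M h (D v) ∘L D‖ ≤ ‖M h (D v)‖ * ‖D‖ := ContinuousLinearMap.opNorm_comp_le _ _
      _ ≤ (‖h‖ * ‖D v‖) * 1 := by gcongr; exact norm_weightedInnerL_apply_le h (D v)
      _ ≤ ‖h‖ * ‖v‖ := by rw [mul_one]; gcongr; exact hD v
  have hcoer_a (y : Lp ℝ ⊤ μ) (hy : ∀ᵐ ω ∂μ, xm / 2 ≤ y ω ∧ y ω ≤ xM + xm / 2) (v : H) :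
      ‖v‖ ^ 2 ≤ C₁ * a y v v := ha_apply y v v ▸ hcoer y hy v
  have hsol (y : Lp ℝ ⊤ μ) (hy : ∀ᵐ ω ∂μ, xm / 2 ≤ y ω ∧ y ω ≤ xM + xm / 2) : a y (W y) = ℓ :=
    ContinuousLinearMap.ext fun w ↦ ha_apply y (W y) w ▸ hW y hy w
  have hWbound (y : Lp ℝ ⊤ μ) (hy : ∀ᵐ ω ∂μ, xm / 2 ≤ y ω ∧ y ω ≤ xM + xm / 2) :
      ‖W y‖ ≤ C₁ * ‖ℓ‖ :=
    hsol y hy ▸ norm_le_mul_norm_apply_of_coercive hC₁ (hcoer_a y hy) (W y)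
  have hx' : ∀ᵐ ω ∂μ, xm / 2 ≤ x ω ∧ x ω ≤ xM + xm / 2 := by
    filter_upwards [hx] with ω hω
    constructor <;> linarith [hω.1, hω.2]
  have hbound := norm_le_mul_norm_apply_of_coercive hC₁ (hcoer_a x hx')
  obtain ⟨W', hW'⟩ := exists_solution_clm_of_coercive hC₁ (hcoer_a x hx')
    (-(ContinuousLinearMap.precomp ℝ D ∘L M.flip (D (W x))))
  replace hW' (h : Lp ℝ ⊤ μ) : a x (W' h) = -(M h (D (W x)) ∘L D) := hW' h
  have hrhs (h : Lp ℝ ⊤ μ) (w : H) : (-(M h (D (W x)) ∘L D)) w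
      = -∫ ω, h ω * ⟪(D (W x)) ω, (D w) ω⟫ ∂μ := by
    rw [← weightedInnerL_apply]
    rfl
  have hW'bound (h : Lp ℝ ⊤ μ) : ‖W' h‖ ≤ C₁ * (C₁ * ‖ℓ‖) * ‖h‖ :=
    calc ‖W' h‖ ≤ C₁ * ‖M h (D (W x)) ∘L D‖ := by simpa [hW'] using hbound (W' h)
      _ ≤ C₁ * (‖h‖ * (C₁ * ‖ℓ‖)) := by
        gcongr
        exact (hM h (W x)).trans (by gcongr; exact hWbound x hx')
      _ = C₁ * (C₁ * ‖ℓ‖) * ‖h‖ := by ring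
  have htaylor (h : Lp ℝ ⊤ μ) (hh : ‖h‖ ≤ xm / 2) :
      ‖W (x + h) - W x - W' h‖ ≤ C₁ * (C₁ * (C₁ * ‖ℓ‖)) * ‖h‖ ^ 2 := by
    have hxh : ∀ᵐ ω ∂μ, xm / 2 ≤ (x + h) ω ∧ (x + h) ω ≤ xM + xm / 2 := by
      filter_upwards [hx, ae_abs_le_norm_of_Lp_top h, Lp.coeFn_add x h] with ω hω hhω hadd
      rw [hadd, Pi.add_apply]
      have := abs_le.1 (hhω.trans hh)
      constructor <;> linarith [hω.1, hω.2, this.1, this.2]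
    have hdiff : a x (W (x + h) - W x) = -(M h (D (W (x + h))) ∘L D) := by
      rw [map_sub, hsol x hx', ← hsol (x + h) hxh, ha_add]
      abel
    have hrem : a x (W (x + h) - W x - W' h) = -(M h (D (W (x + h) - W x)) ∘L D) := by
      rw [map_sub, hdiff, hW', map_sub, map_sub, ContinuousLinearMap.sub_comp]
      abel
    calc ‖W (x + h) - W x - W' h‖
        ≤ C₁ * ‖M h (D (W (x + h) - W x)) ∘L D‖ := by
          simpa only [hrem, norm_neg] using hbound (W (x + h) - W x - W' h)
      _ ≤ C₁ * (‖h‖ * ‖W (x + h) - W x‖) := by gcongr; exact hM h _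
      _ ≤ C₁ * (‖h‖ * (C₁ * ‖M h (D (W (x + h))) ∘L D‖)) := by
          gcongr
          simpa only [hdiff, norm_neg] using hbound (W (x + h) - W x)
      _ ≤ C₁ * (‖h‖ * (C₁ * (‖h‖ * (C₁ * ‖ℓ‖)))) := by
          gcongr
          exact (hM h _).trans (by gcongr; exact hWbound _ hxh)
      _ = C₁ * (C₁ * (C₁ * ‖ℓ‖)) * ‖h‖ ^ 2 := by ring
  refine ⟨W', fun h w ↦ ?_, fun h v hv ↦ ?_, hW'bound,
    W'.opNorm_le_bound (by positivity) hW'bound, htaylor,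
    hasFDerivAt_of_norm_sub_le_sq (half_pos hxm) htaylor⟩
  · rw [← ha_apply, hW', hrhs]
  · refine injective_of_coercive hC₁ (hcoer_a x hx') (ContinuousLinearMap.ext fun w ↦ ?_)
    rw [hW', hrhs, ha_apply]
    exact hv w
end

section
/- For all x, z in the closed ball B(x̄, δ) and every β > 0, one has ⟨∇E(z), x − x̄⟩ ≥ E(x) − E(x̄) + ((1 − β)/2)‖S′(z)(x − x̄)‖² − (1/(2β))‖S′(z)(x − z)‖² − (A/2)‖x − x̄‖² − (B/2)‖x − z‖², where A := S″_max(2‖S(x̄) − b‖ + δ²S″_max/2) and B := S″_max(S′_maxδ + 3‖S(x̄) − b‖ + δ²S″_max/2). -/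
open scoped RealInnerProductSpace

/-- If `S'` is `L`-Lipschitz on a convex set, the error of replacing `S` by its linearization at `z`
along the segment from `y₁` to `y₂` is controlled by the distances of the endpoints to `z`. -/
theorem norm_sub_sub_apply_le_of_lipschitz_fderiv
    {X Z : Type*} [NormedAddCommGroup X] [NormedSpace ℝ X]
    [NormedAddCommGroup Z] [NormedSpace ℝ Z]
    {s : Set X} (hs : Convex ℝ s) {S : X → Z} {S' : X → X →L[ℝ] Z} {L : ℝ} (hL : 0 ≤ L)
    (hS : ∀ x ∈ s, HasFDerivWithinAt S (S' x) s x)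
    (hLip : ∀ x ∈ s, ∀ y ∈ s, ‖S' x - S' y‖ ≤ L * ‖x - y‖)
    {y₁ y₂ z : X} (h₁ : y₁ ∈ s) (h₂ : y₂ ∈ s) (hz : z ∈ s) :
    ‖S y₂ - S y₁ - S' z (y₂ - y₁)‖
      ≤ L / 2 * ‖y₂ - y₁‖ * (‖y₁ - z‖ + ‖y₂ - z‖) := by
  set v := y₂ - y₁ with hv
  have hmem : ∀ t ∈ Set.Icc (0 : ℝ) 1, y₁ + t • v ∈ s := fun t ht =>
    hs.add_smul_sub_mem h₁ h₂ ht
  have hf : ∀ t ∈ Set.Icc (0 : ℝ) 1,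
      HasDerivWithinAt (fun t : ℝ => S (y₁ + t • v) - S y₁ - t • S' z v)
        (S' (y₁ + t • v) v - S' z v) (Set.Icc 0 1) t := by
    intro t ht
    have hline : HasDerivWithinAt (fun t : ℝ => y₁ + t • v) v (Set.Icc 0 1) t := by
      simpa using (((hasDerivAt_id t).smul_const v).const_add y₁).hasDerivWithinAt
    have hlin : HasDerivWithinAt (fun t : ℝ => t • S' z v) (S' z v) (Set.Icc 0 1) t := by
      simpa using ((hasDerivAt_id t).smul_const (S' z v)).hasDerivWithinAt
    exact (((hS _ (hmem t ht)).comp_hasDerivWithinAt t hline hmem).sub_const _).sub hlin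
  have hB : ∀ t : ℝ, HasDerivAt
      (fun t : ℝ => L * ‖v‖ * ((t - t ^ 2 / 2) * ‖y₁ - z‖ + t ^ 2 / 2 * ‖y₂ - z‖))
      (L * ‖v‖ * ((1 - t) * ‖y₁ - z‖ + t * ‖y₂ - z‖)) t := by
    intro t
    have hsq : HasDerivAt (fun t : ℝ => t ^ 2 / 2) t t := by
      simpa using ((hasDerivAt_id t).pow 2).div_const 2
    exact ((((hasDerivAt_id t).sub hsq).mul_const _).add (hsq.mul_const _)).const_mul _
  have key := image_norm_le_of_norm_deriv_right_le_deriv_boundary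
    (fun t ht => (hf t ht).continuousWithinAt)
    (fun t ht => (hf t (Set.Ico_subset_Icc_self ht)).mono_of_mem_nhdsWithin
      (Icc_mem_nhdsGE_of_mem ht)) (by simp) hB ?_ (Set.right_mem_Icc.2 zero_le_one)
  · have hend : y₁ + (1 : ℝ) • v = y₂ := by simp [hv]
    simp only [hend] at key
    rw [one_smul] at key
    linarith
  · intro t ht
    have ht' := Set.Ico_subset_Icc_self ht
    have hdist : ‖y₁ + t • v - z‖ ≤ (1 - t) * ‖y₁ - z‖ + t * ‖y₂ - z‖ := by
      have : y₁ + t • v - z = (1 - t) • (y₁ - z) + t • (y₂ - z) := by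
        rw [hv]; module
      rw [this]
      refine (norm_add_le _ _).trans_eq ?_
      rw [norm_smul, norm_smul, Real.norm_of_nonneg (sub_nonneg.2 ht'.2),
        Real.norm_of_nonneg ht'.1]
    calc ‖S' (y₁ + t • v) v - S' z v‖ = ‖(S' (y₁ + t • v) - S' z) v‖ := by simp
      _ ≤ ‖S' (y₁ + t • v) - S' z‖ * ‖v‖ := ContinuousLinearMap.le_opNorm _ _
      _ ≤ L * ‖y₁ + t • v - z‖ * ‖v‖ := by gcongr; exact hLip _ (hmem t ht') _ hz
      _ ≤ L * ((1 - t) * ‖y₁ - z‖ + t * ‖y₂ - z‖) * ‖v‖ := by gcongr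
      _ = _ := by ring

/-- basic three-point estimate for the nonlinear least squares data term
`E(x) = ½‖S(x) − b‖²` with gradient `∇E(z) = S′(z)*(S(z) − b)`. -/
theorem stmt12
    {X Z : Type*} [NormedAddCommGroup X] [InnerProductSpace ℝ X] [CompleteSpace X]
    [NormedAddCommGroup Z] [InnerProductSpace ℝ Z] [CompleteSpace Z]
    (b : Z) (xbar : X) (δ : ℝ) (hδ : 0 < δ)
    (S : X → Z) (S' : X → X →L[ℝ] Z) (S'' : X → X →L[ℝ] X →L[ℝ] Z)
    -- twice Fréchet differentiability on the closed ball
    (hdiff1 : ∀ x ∈ Metric.closedBall xbar δ,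
      HasFDerivWithinAt S (S' x) (Metric.closedBall xbar δ) x)
    (hdiff2 : ∀ x ∈ Metric.closedBall xbar δ,
      HasFDerivWithinAt S' (S'' x) (Metric.closedBall xbar δ) x)
    (S'max S''max : ℝ) (hS'max : 0 ≤ S'max) (hS''max : 0 ≤ S''max)
    (hS'b : ∀ x ∈ Metric.closedBall xbar δ, ∀ h : X, ‖S' x h‖ ≤ S'max * ‖h‖)
    (hS''b : ∀ x ∈ Metric.closedBall xbar δ, ∀ h k : X,
      ‖S'' x h k‖ ≤ S''max * ‖h‖ * ‖k‖)
    (x z : X) (hx : x ∈ Metric.closedBall xbar δ) (hz : z ∈ Metric.closedBall xbar δ)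
    (β : ℝ) (hβ : 0 < β) :
    ⟪(ContinuousLinearMap.adjoint (S' z)) (S z - b), x - xbar⟫
      ≥ (1 / 2 * ‖S x - b‖ ^ 2 - 1 / 2 * ‖S xbar - b‖ ^ 2)
        + (1 - β) / 2 * ‖S' z (x - xbar)‖ ^ 2
        - 1 / (2 * β) * ‖S' z (x - z)‖ ^ 2
        - S''max * (2 * ‖S xbar - b‖ + δ ^ 2 * S''max / 2) / 2 * ‖x - xbar‖ ^ 2
        - S''max * (S'max * δ + 3 * ‖S xbar - b‖ + δ ^ 2 * S''max / 2) / 2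
            * ‖x - z‖ ^ 2 := by
  set s := Metric.closedBall xbar δ with hs
  have hconv : Convex ℝ s := convex_closedBall xbar δ
  have hxbar : xbar ∈ s := Metric.mem_closedBall_self hδ.le
  have hLip : ∀ y ∈ s, ∀ y' ∈ s, ‖S' y - S' y'‖ ≤ S''max * ‖y - y'‖ := fun y hy y' hy' =>
    hconv.norm_image_sub_le_of_norm_hasFDerivWithin_le hdiff2
      (fun u hu => (S'' u).opNorm_le_bound₂ hS''max (hS''b u hu)) hy' hy
  have hx' : ‖x - xbar‖ ≤ δ := mem_closedBall_iff_norm.1 hx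
  have hz' : ‖z - xbar‖ ≤ δ := mem_closedBall_iff_norm.1 hz
  have hr₁ := norm_sub_sub_apply_le_of_lipschitz_fderiv hconv hS''max hdiff1 hLip hxbar hz hz
  have hr₂ := norm_sub_sub_apply_le_of_lipschitz_fderiv hconv hS''max hdiff1 hLip hz hx hz
  have hr := norm_sub_sub_apply_le_of_lipschitz_fderiv hconv hS''max hdiff1 hLip hxbar hx hz
  rw [sub_self, norm_zero, norm_sub_rev xbar z] at *
  rw [ContinuousLinearMap.adjoint_inner_left]
  have hKh : ‖S' z (x - xbar)‖ ≤ S'max * δ := (hS'b z hz _).trans (by gcongr)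
  have hparallelogram : ‖z - xbar‖ ^ 2 ≤ 2 * ‖x - xbar‖ ^ 2 + 2 * ‖x - z‖ ^ 2 := by
    have h := norm_sub_le (x - xbar) (x - z)
    rw [sub_sub_sub_cancel_left] at h
    nlinarith [norm_nonneg (z - xbar), sq_nonneg (‖x - xbar‖ - ‖x - z‖)]
  have hadd : S' z (x - xbar) = S' z (z - xbar) + S' z (x - z) := by
    rw [← map_add]; congr 1; abel
  set w := S xbar - b with hw
  set p := S' z (x - xbar)
  set q := S' z (x - z)
  set r₁ := S z - S xbar - S' z (z - xbar) with hr₁_def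
  set r₂ := S x - S z - q with hr₂_def
  set r := S x - S xbar - p with hr_def
  have hrsum : r = r₁ + r₂ := by rw [hr_def, hr₁_def, hr₂_def, hadd]; abel
  have hSz : S z - b = w + (p - q) + r₁ := by rw [hw, hr₁_def, hadd]; abel
  have hSx : S x - b = w + p + r := by rw [hw, hr_def]; abel
  have hyoung : ⟪q, p⟫ ≤ β / 2 * ‖p‖ ^ 2 + 1 / (2 * β) * ‖q‖ ^ 2 := by
    have h := real_inner_le_norm q p
    have h' : β / 2 * ‖p‖ ^ 2 + 1 / (2 * β) * ‖q‖ ^ 2 - ‖q‖ * ‖p‖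
        = 1 / (2 * β) * (β * ‖p‖ - ‖q‖) ^ 2 := by field_simp; ring
    have : 0 ≤ 1 / (2 * β) * (β * ‖p‖ - ‖q‖) ^ 2 := by positivity
    linarith
  have hwr : ⟪w, r⟫ ≤ ‖w‖ * (S''max / 2 * (2 * ‖x - xbar‖ ^ 2 + 3 * ‖x - z‖ ^ 2)) := by
    refine (real_inner_le_norm w r).trans ?_
    gcongr
    rw [hrsum]
    refine (norm_add_le _ _).trans ?_
    nlinarith
  have hr₂p : ⟪r₂, p⟫ ≤ S''max / 2 * ‖x - z‖ ^ 2 * (S'max * δ) := by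
    refine (real_inner_le_norm r₂ p).trans ?_
    have : ‖r₂‖ ≤ S''max / 2 * ‖x - z‖ ^ 2 := by linarith
    gcongr
  have hrsq : ‖r‖ ^ 2 ≤ S''max ^ 2 * δ ^ 2 / 2 * (‖x - xbar‖ ^ 2 + ‖x - z‖ ^ 2) := by
    calc ‖r‖ ^ 2 ≤ (S''max / 2 * ‖x - xbar‖ * (‖z - xbar‖ + ‖x - z‖)) ^ 2 := by gcongr
      _ = S''max ^ 2 / 4 * (‖x - xbar‖ ^ 2 * (‖z - xbar‖ + ‖x - z‖) ^ 2) := by ring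
      _ ≤ S''max ^ 2 / 4 * (‖x - xbar‖ ^ 2 * (2 * (‖z - xbar‖ ^ 2 + ‖x - z‖ ^ 2))) := by
        gcongr; exact add_sq_le
      _ = S''max ^ 2 / 2 * (‖x - xbar‖ ^ 2 * ‖z - xbar‖ ^ 2
            + ‖x - xbar‖ ^ 2 * ‖x - z‖ ^ 2) := by ring
      _ ≤ S''max ^ 2 / 2 * (‖x - xbar‖ ^ 2 * δ ^ 2 + δ ^ 2 * ‖x - z‖ ^ 2) := by gcongr
      _ = _ := by ring
  have hexpand : ⟪S z - b, p⟫ = 1 / 2 * ‖S x - b‖ ^ 2 - 1 / 2 * ‖w‖ ^ 2 + 1 / 2 * ‖p‖ ^ 2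
      - ⟪q, p⟫ - ⟪w, r⟫ - ⟪r₂, p⟫ - 1 / 2 * ‖r‖ ^ 2 := by
    have hr₁' : r₁ = r - r₂ := by rw [hrsum]; abel
    rw [hSz, hSx, hr₁', ← real_inner_self_eq_norm_sq, ← real_inner_self_eq_norm_sq,
      ← real_inner_self_eq_norm_sq, ← real_inner_self_eq_norm_sq]
    simp only [inner_add_left, inner_add_right, inner_sub_left]
    rw [real_inner_comm w p, real_inner_comm w r, real_inner_comm p r]
    ring
  rw [hexpand]
  linarith
end

section
/- Let C ⊆ X be a convex set on which S is twice Fréchet differentiable with the stated bounds, and suppose additionally ‖S(x) − b‖ ≤ S_max for all x ∈ C. Then for all x, x_j ∈ C and all x̄ ∈ X with ‖x − x̄‖ ≤ δ, the delayed-linearisation gradient error satisfies ⟨∇E(x_j) − ∇E(x), x − x̄⟩ ≤ (S″_max·S_max + (S′_max)²)·δ·‖x_j − x‖. Consequently, if E obeys a three-point smoothness inequality with the exact gradient ∇E(x), the same inequality holds with the delayed gradient ∇E(x_j) up to the additive error (S″_max·S_max + (S′_max)²)·δ·‖x_j − x‖. -/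
open scoped RealInnerProductSpace

/-- The gradient of a nonlinear least squares functional is Lipschitz on a convex set, when tested
against a fixed direction. -/
theorem abs_inner_adjoint_residual_sub_le
    {X Z : Type*} [NormedAddCommGroup X] [InnerProductSpace ℝ X] [CompleteSpace X]
    [NormedAddCommGroup Z] [InnerProductSpace ℝ Z] [CompleteSpace Z]
    {b : Z} {M M' M'' : ℝ} (hM' : 0 ≤ M') (hM'' : 0 ≤ M'')
    {C : Set X} (hC : Convex ℝ C)
    {S : X → Z} {S' : X → X →L[ℝ] Z} {S'' : X → X →L[ℝ] X →L[ℝ] Z}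
    (hS : ∀ x ∈ C, HasFDerivWithinAt S (S' x) C x)
    (hS' : ∀ x ∈ C, HasFDerivWithinAt S' (S'' x) C x)
    (hS'b : ∀ x ∈ C, ∀ h : X, ‖S' x h‖ ≤ M' * ‖h‖)
    (hS''b : ∀ x ∈ C, ∀ h k : X, ‖S'' x h k‖ ≤ M'' * ‖h‖ * ‖k‖)
    (hres : ∀ x ∈ C, ‖S x - b‖ ≤ M) {x y : X} (hx : x ∈ C) (hy : y ∈ C) (h : X) :
    |⟪(ContinuousLinearMap.adjoint (S' y)) (S y - b)
        - (ContinuousLinearMap.adjoint (S' x)) (S x - b), h⟫|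
      ≤ (M'' * M + M' ^ 2) * ‖h‖ * ‖y - x‖ := by
  have lip : ‖S y - S x‖ ≤ M' * ‖y - x‖ :=
    hC.norm_image_sub_le_of_norm_hasFDerivWithin_le hS
      (fun z hz => (S' z).opNorm_le_bound hM' (hS'b z hz)) hx hy
  have lip' : ‖S' y - S' x‖ ≤ M'' * ‖y - x‖ :=
    hC.norm_image_sub_le_of_norm_hasFDerivWithin_le hS'
      (fun z hz => (S'' z).opNorm_le_bound₂ hM'' (hS''b z hz)) hx hy
  have split : ⟪(ContinuousLinearMap.adjoint (S' y)) (S y - b)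
        - (ContinuousLinearMap.adjoint (S' x)) (S x - b), h⟫
      = ⟪S y - b, (S' y - S' x) h⟫ + ⟪S y - S x, S' x h⟫ := by
    simp only [inner_sub_left, ContinuousLinearMap.adjoint_inner_left, map_sub,
      sub_apply, inner_sub_right]
    ring
  rw [split]
  have hM : 0 ≤ M := (norm_nonneg _).trans (hres y hy)
  calc _ ≤ |⟪S y - b, (S' y - S' x) h⟫| + |⟪S y - S x, S' x h⟫| := abs_add_le _ _
    _ ≤ ‖S y - b‖ * ‖(S' y - S' x) h‖ + ‖S y - S x‖ * ‖S' x h‖ :=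
        add_le_add (abs_real_inner_le_norm _ _) (abs_real_inner_le_norm _ _)
    _ ≤ M * (M'' * ‖y - x‖ * ‖h‖) + M' * ‖y - x‖ * (M' * ‖h‖) := by
        gcongr
        · exact hres y hy
        · exact (S' y - S' x).le_of_opNorm_le lip' h
        · exact hS'b x hx h
    _ = _ := by ring

/-- bound on the delayed-linearisation gradient error for the nonlinear
least squares data term `E(x) = ½‖S(x) − b‖²`, and the resulting stability of
three-point smoothness inequalities under delayed gradients. -/
theorem stmt16
    {X Z : Type*} [NormedAddCommGroup X] [InnerProductSpace ℝ X] [CompleteSpace X]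
    [NormedAddCommGroup Z] [InnerProductSpace ℝ Z] [CompleteSpace Z]
    (b : Z) (δ : ℝ) (hδ : 0 < δ)
    (Smax S'max S''max : ℝ) (hSmax : 0 ≤ Smax) (hS'max : 0 ≤ S'max)
    (hS''max : 0 ≤ S''max)
    (C : Set X) (hC : Convex ℝ C)
    (S : X → Z) (S' : X → X →L[ℝ] Z) (S'' : X → X →L[ℝ] X →L[ℝ] Z)
    -- twice Fréchet differentiability on `C` with the stated bounds
    (hdiff1 : ∀ x ∈ C, HasFDerivWithinAt S (S' x) C x)
    (hdiff2 : ∀ x ∈ C, HasFDerivWithinAt S' (S'' x) C x)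
    (hS'b : ∀ x ∈ C, ∀ h : X, ‖S' x h‖ ≤ S'max * ‖h‖)
    (hS''b : ∀ x ∈ C, ∀ h k : X, ‖S'' x h k‖ ≤ S''max * ‖h‖ * ‖k‖)
    -- the residual bound on `C`
    (hres : ∀ x ∈ C, ‖S x - b‖ ≤ Smax) :
    ∀ x ∈ C, ∀ xj ∈ C, ∀ xbar : X, ‖x - xbar‖ ≤ δ →
      -- the delayed-linearisation gradient error bound
      (⟪(ContinuousLinearMap.adjoint (S' xj)) (S xj - b)
          - (ContinuousLinearMap.adjoint (S' x)) (S x - b), x - xbar⟫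
        ≤ (S''max * Smax + S'max ^ 2) * δ * ‖xj - x‖) ∧
      -- consequently any three-point smoothness inequality with the exact gradient
      -- also holds with the delayed gradient, up to the same additive error
      (∀ γE L e : ℝ, ∀ xbrev : X,
        (⟪(ContinuousLinearMap.adjoint (S' x)) (S x - b), x - xbar⟫
          ≥ (1 / 2 * ‖S x - b‖ ^ 2 - 1 / 2 * ‖S xbar - b‖ ^ 2)
            + γE / 2 * ‖x - xbar‖ ^ 2 - L / 2 * ‖x - xbrev‖ ^ 2 - e) →
        ⟪(ContinuousLinearMap.adjoint (S' xj)) (S xj - b), x - xbar⟫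
          ≥ (1 / 2 * ‖S x - b‖ ^ 2 - 1 / 2 * ‖S xbar - b‖ ^ 2)
            + γE / 2 * ‖x - xbar‖ ^ 2 - L / 2 * ‖x - xbrev‖ ^ 2 - e
            - (S''max * Smax + S'max ^ 2) * δ * ‖xj - x‖) := by
  intro x hx xj hxj xbar hxbar
  have key : |⟪(ContinuousLinearMap.adjoint (S' xj)) (S xj - b)
        - (ContinuousLinearMap.adjoint (S' x)) (S x - b), x - xbar⟫|
      ≤ (S''max * Smax + S'max ^ 2) * δ * ‖xj - x‖ :=
    (abs_inner_adjoint_residual_sub_le hS'max hS''max hC hdiff1 hdiff2 hS'b hS''b hres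
      hx hxj (x - xbar)).trans (by gcongr)
  refine ⟨(le_abs_self _).trans key, fun γE L e xbrev hsmooth => ?_⟩
  have lower := (abs_le.mp key).1
  rw [inner_sub_left] at lower
  linarith
end
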